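/- Let a PFCT-S instance have sources [n] with supplies a ∈ ℤ_{>0}^{[n]} and costs f_1 ≥ f_2 ≥ … ≥ f_n ≥ 0, and sinks [m] with demands b_1 ≥ b_2 ≥ … ≥ b_m > 0, with ∑ a_i = ∑ b_j. Let ε > 0 be such that q := n/ε is a positive integer, and let x* ∈ 𝒳 be an optimum solution (minimizing cost_f over 𝒳) in whose support every sink is incident to exactly one source (supp(x*) is a disjoint union of stars centered at sources). Then there exists x ∈ 𝒳 with cost_f(x) ≤ (1 + ε) · cost_f(x*) such that the q most expensive edges of supp(x) are all incident to the sinks [q]; precisely, for every (i, j) ∈ supp(x) with j > q there exist at least q pairs (i', j') ∈ supp(x) with j' ≤ q and f_{i'} ≥ f_i. -/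

import Mathlib

open Finset

/-- PFCT-S cost of a solution `x`: `∑_{(i,j) : x_{ij} > 0} f_i`. -/
noncomputable def costF {n m : ℕ} (f : Fin n → ℝ) (x : Fin n → Fin m → ℝ) : ℝ :=
  ∑ i : Fin n, ∑ j : Fin m, if 0 < x i j then f i else 0

/-- The part of the amounts `r` on `P` carried by the indices below `t`. -/
noncomputable def partialSum {m : ℕ} (P : Finset (Fin m)) (r : Fin m → ℝ) (t : ℕ) : ℝ :=
  ∑ j ∈ P with j.val < t, r j

/-- Distribute `c` over the sinks of `P`, in increasing order, with capacities `r`. -/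
noncomputable def fill {m : ℕ} (P : Finset (Fin m)) (c : ℝ) (r : Fin m → ℝ) (j : Fin m) : ℝ :=
  min c (partialSum P r (j + 1)) - min c (partialSum P r j)

/-- Residual demands after the first `i` sources have been distributed greedily. -/
noncomputable def residualDemand {m : ℕ} (P : ℕ → Finset (Fin m)) (a : ℕ → ℝ) (b : Fin m → ℝ) :
    ℕ → Fin m → ℝ
  | 0 => b
  | i + 1 => fun j => residualDemand P a b i j - fill (P i) (a i) (residualDemand P a b i) j

/-- The greedy transportation plan, source `i` being allowed to serve the sinks of `P i`. -/
noncomputable def greedy {m : ℕ} (P : ℕ → Finset (Fin m)) (a : ℕ → ℝ) (b : Fin m → ℝ)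
    (i : ℕ) (j : Fin m) : ℝ :=
  fill (P i) (a i) (residualDemand P a b i) j

section Fill

variable {m : ℕ} {P : Finset (Fin m)} {c : ℝ} {r : Fin m → ℝ}

lemma partialSum_succ (j : Fin m) :
    partialSum P r (j + 1) = partialSum P r j + if j ∈ P then r j else 0 := by
  have h : P.filter (fun j' : Fin m => j'.val < j.val + 1)
      = P.filter (fun j' : Fin m => j'.val < j.val) ∪ P.filter (fun j' => j' = j) := by
    ext j'
    simp only [mem_filter, mem_union, Fin.ext_iff]
    grind
  have hd : Disjoint (P.filter (fun j' : Fin m => j'.val < j.val))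
      (P.filter (fun j' => j' = j)) := by
    rw [Finset.disjoint_left]
    intro j' h1 h2
    simp only [mem_filter] at h1 h2
    rw [h2.2] at h1
    omega
  unfold partialSum
  rw [h, sum_union hd, Finset.filter_eq']
  split_ifs <;> simp

lemma partialSum_mono (hr : ∀ j, 0 ≤ r j) {t t' : ℕ} (h : t ≤ t') :
    partialSum P r t ≤ partialSum P r t' := by
  apply sum_le_sum_of_subset_of_nonneg
  · intro j
    simp only [mem_filter]
    grind
  · intro j _ _
    exact hr j

lemma fill_nonneg (hr : ∀ j, 0 ≤ r j) (j : Fin m) : 0 ≤ fill P c r j :=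
  sub_nonneg.2 (min_le_min_left _ (partialSum_mono hr (Nat.le_succ _)))

lemma fill_le_ite (hr : ∀ j, 0 ≤ r j) (j : Fin m) :
    fill P c r j ≤ if j ∈ P then r j else 0 := by
  have h := partialSum_succ (P := P) (r := r) j
  have h0 : 0 ≤ if j ∈ P then r j else 0 := by
    split_ifs
    exacts [hr j, le_rfl]
  unfold fill
  rw [h]
  rcases min_cases c (partialSum P r j) with h1 | h1 <;>
  rcases min_cases c (partialSum P r j + if j ∈ P then r j else 0) with h2 | h2 <;> linarith

lemma fill_le (hr : ∀ j, 0 ≤ r j) (j : Fin m) : fill P c r j ≤ r j := by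
  refine (fill_le_ite hr j).trans ?_
  split_ifs
  exacts [le_rfl, hr j]

lemma mem_of_fill_pos (hr : ∀ j, 0 ≤ r j) {j : Fin m} (h : 0 < fill P c r j) : j ∈ P := by
  by_contra hj
  have := fill_le_ite (P := P) (c := c) hr j
  rw [if_neg hj] at this
  linarith

lemma sum_fill (hc : 0 ≤ c) : ∑ j, fill P c r j = min c (∑ j ∈ P, r j) := by
  unfold fill
  rw [Fin.sum_univ_eq_sum_range
    (fun j => min c (partialSum P r (j + 1)) - min c (partialSum P r j)),
    Finset.sum_range_sub (fun j => min c (partialSum P r j))]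
  simp [partialSum, hc]

lemma fill_eq_of_lt (hr : ∀ j, 0 ≤ r j) {j j' : Fin m} (hj : j < j')
    (hP : j ∈ P) (h : 0 < fill P c r j') : fill P c r j = r j := by
  have h1 : partialSum P r j' < c := by
    by_contra! hc
    have h2 := hc.trans (partialSum_mono (P := P) hr (Nat.le_succ j'))
    unfold fill at h
    rw [min_eq_left hc, min_eq_left h2] at h
    linarith
  have h2 : partialSum P r (j + 1) ≤ c :=
    (partialSum_mono hr (Nat.succ_le_of_lt hj)).trans h1.le
  have h3 : partialSum P r j ≤ c := (partialSum_mono hr (Nat.le_succ _)).trans h2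
  unfold fill
  rw [min_eq_right h2, min_eq_right h3, partialSum_succ, if_pos hP]
  ring

end Fill

section Greedy

variable {m : ℕ} {P : ℕ → Finset (Fin m)} {a : ℕ → ℝ} {b : Fin m → ℝ}

lemma residualDemand_nonneg (hb : ∀ j, 0 ≤ b j) (i : ℕ) (j : Fin m) :
    0 ≤ residualDemand P a b i j := by
  induction i generalizing j with
  | zero => exact hb j
  | succ i ih => exact sub_nonneg.2 (fill_le ih j)

lemma residualDemand_succ (i : ℕ) (j : Fin m) :
    residualDemand P a b (i + 1) j = residualDemand P a b i j - greedy P a b i j := rfl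

lemma residualDemand_eq (i : ℕ) (j : Fin m) :
    residualDemand P a b i j = b j - ∑ i' ∈ range i, greedy P a b i' j := by
  induction i with
  | zero => simp [residualDemand]
  | succ i ih => rw [residualDemand_succ, ih, sum_range_succ]; ring

lemma greedy_nonneg (hb : ∀ j, 0 ≤ b j) (i : ℕ) (j : Fin m) : 0 ≤ greedy P a b i j :=
  fill_nonneg (residualDemand_nonneg hb i) j

lemma residualDemand_anti (hb : ∀ j, 0 ≤ b j) (j : Fin m) :
    Antitone fun i => residualDemand P a b i j := by
  refine antitone_nat_of_succ_le fun i => ?_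
  rw [residualDemand_succ]
  linarith [greedy_nonneg (P := P) (a := a) hb i j]

lemma exists_greedy_pos {i : ℕ} {j : Fin m} (hb : 0 < b j) (h : residualDemand P a b i j = 0) :
    ∃ i' < i, 0 < greedy P a b i' j := by
  by_contra! hc
  rw [residualDemand_eq] at h
  have := sum_nonpos (s := range i) (f := fun i' => greedy P a b i' j)
    fun i' hi' => hc i' (mem_range.1 hi')
  linarith

lemma residualDemand_eq_zero_of_lt (hb : ∀ j, 0 ≤ b j) {i : ℕ} {j j' : Fin m} (hj : j < j')
    (hP : j ∈ P i) (h : 0 < greedy P a b i j') : residualDemand P a b (i + 1) j = 0 := by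
  have : greedy P a b i j = residualDemand P a b i j :=
    fill_eq_of_lt (residualDemand_nonneg hb i) hj hP h
  rw [residualDemand_succ, this, sub_self]

lemma card_greedy_pos_add_le (hb : ∀ j, 0 ≤ b j) (i : ℕ) :
    #{j | 0 < greedy P a b i j} + #{j | residualDemand P a b i j = 0}
      ≤ #{j | residualDemand P a b (i + 1) j = 0} + 1 := by
  classical
  have hcross : #{j | 0 < greedy P a b i j ∧ residualDemand P a b (i + 1) j ≠ 0} ≤ 1 := by
    have key : ∀ j j' : Fin m, 0 < greedy P a b i j → 0 < greedy P a b i j' →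
        residualDemand P a b (i + 1) j ≠ 0 → ¬ j < j' := fun j j' h h' h0 hlt =>
      h0 (residualDemand_eq_zero_of_lt hb hlt (mem_of_fill_pos (residualDemand_nonneg hb i) h) h')
    rw [card_le_one]
    intro j hj j' hj'
    simp only [mem_filter, mem_univ, true_and] at hj hj'
    exact le_antisymm (not_lt.1 (key j' j hj'.1 hj.1 hj'.2)) (not_lt.1 (key j j' hj.1 hj'.1 hj.2))
  have hfin : #{j | 0 < greedy P a b i j ∧ residualDemand P a b (i + 1) j = 0}
      + #{j | residualDemand P a b i j = 0} ≤ #{j | residualDemand P a b (i + 1) j = 0} := by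
    rw [← card_union_of_disjoint]
    · refine card_le_card fun j hj => ?_
      simp only [mem_union, mem_filter, mem_univ, true_and] at hj ⊢
      rcases hj with hj | hj
      · exact hj.2
      · refine le_antisymm ?_ (residualDemand_nonneg hb _ _)
        exact hj ▸ residualDemand_anti hb j (Nat.le_succ i)
    · rw [Finset.disjoint_left]
      intro j hj hj'
      simp only [mem_filter, mem_univ, true_and] at hj hj'
      have h1 := fill_le (P := P i) (c := a i) (residualDemand_nonneg (P := P) (a := a) hb i) j
      have h2 : 0 < fill (P i) (a i) (residualDemand P a b i) j := hj.1
      linarith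
  have hsplit := card_filter_add_card_filter_not (s := univ.filter fun j => 0 < greedy P a b i j)
    (fun j => residualDemand P a b (i + 1) j = 0)
  rw [filter_filter, filter_filter] at hsplit
  simp only [ne_eq] at hcross
  omega

lemma sum_card_greedy_pos_le (hb : ∀ j, 0 ≤ b j) (l : ℕ) :
    ∑ i ∈ range l, #{j | 0 < greedy P a b i j} ≤ #{j | residualDemand P a b l j = 0} + l := by
  induction l with
  | zero => simp
  | succ l ih =>
    rw [sum_range_succ]
    have := card_greedy_pos_add_le (P := P) (a := a) hb l
    omega

end Greedy

lemma sum_mul_nonneg_of_antitone {f w : ℕ → ℝ} (hf : Antitone f) (hf0 : ∀ i, 0 ≤ f i)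
    (hw : ∀ l, 0 ≤ ∑ i ∈ range l, w i) (l : ℕ) : 0 ≤ ∑ i ∈ range l, f i * w i := by
  have h : ∀ l, f l * ∑ i ∈ range l, w i ≤ ∑ i ∈ range l, f i * w i := by
    intro l
    induction l with
    | zero => simp
    | succ l ih =>
      have h1 := mul_le_mul_of_nonneg_right (hf (Nat.le_succ l)) (hw (l + 1))
      rw [sum_range_succ] at h1 ⊢
      rw [sum_range_succ]
      rw [Nat.succ_eq_add_one] at h1
      nlinarith
  exact (mul_nonneg (hf0 l) (hw l)).trans (h l)

/-- The number of elements of `T` below `j`. -/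
def rankIn {m : ℕ} (T : Finset (Fin m)) (j : Fin m) : Fin m :=
  ⟨#{j' ∈ T | j' < j}, by
    refine lt_of_le_of_lt (card_le_card (t := Iio j) fun j' hj' => ?_) (by simp)
    exact mem_Iio.2 (mem_filter.1 hj').2⟩

section Rank

variable {m : ℕ} (T : Finset (Fin m))

lemma rankIn_le (j : Fin m) : rankIn T j ≤ j := by
  have h : #{j' ∈ T | j' < j} ≤ #(Iio j) :=
    card_le_card fun j' hj' => mem_Iio.2 (mem_filter.1 hj').2
  rw [Fin.card_Iio] at h
  exact h

lemma rankIn_lt_of_lt {j j' : Fin m} (hj : j ∈ T) (h : j < j') : rankIn T j < rankIn T j' := by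
  refine Fin.mk_lt_mk.2 (card_lt_card ?_)
  rw [ssubset_iff_of_subset fun x hx =>
    mem_filter.2 ⟨(mem_filter.1 hx).1, (mem_filter.1 hx).2.trans h⟩]
  exact ⟨j, by simp [hj, h], by simp⟩

lemma rankIn_injOn : Set.InjOn (rankIn T) T := by
  intro j hj j' hj' h
  rcases lt_trichotomy j j' with hlt | heq | hlt
  · exact absurd h (rankIn_lt_of_lt T hj hlt).ne
  · exact heq
  · exact absurd h (rankIn_lt_of_lt T hj' hlt).ne'

lemma rankIn_lt_card {j : Fin m} (hj : j ∈ T) : (rankIn T j : ℕ) < #T := by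
  refine card_lt_card ?_
  rw [ssubset_iff_of_subset (filter_subset _ _)]
  exact ⟨j, hj, by simp⟩

lemma sum_le_sum_image_rankIn {b : Fin m → ℝ} (hb : Antitone b) {S : Finset (Fin m)}
    (hS : S ⊆ T) : ∑ j ∈ S, b j ≤ ∑ j ∈ S.image (rankIn T), b j := by
  rw [sum_image fun j hj j' hj' => rankIn_injOn T (hS hj) (hS hj')]
  exact sum_le_sum fun j _ => hb (rankIn_le T j)

lemma sum_le_sum_lt_card {b : Fin m → ℝ} (hb : Antitone b) (hb0 : ∀ j, 0 ≤ b j) :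
    ∑ j ∈ T, b j ≤ ∑ j with j.val < #T, b j := by
  refine (sum_le_sum_image_rankIn T hb subset_rfl).trans
    (sum_le_sum_of_subset_of_nonneg (fun j hj => ?_) fun j _ _ => hb0 j)
  obtain ⟨j', hj', rfl⟩ := mem_image.1 hj
  simpa using rankIn_lt_card T hj'

end Rank

section Stars

variable {m : ℕ} (s : Fin m → ℕ) (b : Fin m → ℝ) (k : ℕ)

/-- The sinks served by the first `l` sources when sink `j` is served by source `s j`. -/
def servedBelow (l : ℕ) : Finset (Fin m) := {j | s j < l}

/-- The supply of source `i` when sink `j` is served by source `s j`. -/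
noncomputable def starSupply (i : ℕ) : ℝ := ∑ j with s j = i, b j

/-- The sinks allowed to source `i`: the stars of the first `k` sources are moved injectively
to the sinks of largest demand, all other sources are unrestricted. -/
def allowed (i : ℕ) : Finset (Fin m) :=
  if i < k then ({j | s j = i} : Finset (Fin m)).image (rankIn (servedBelow s k)) else univ

/-- The greedy plan that starts from a union of stars. -/
noncomputable def starPlan (i : ℕ) (j : Fin m) : ℝ :=
  greedy (allowed s k) (starSupply s b) b i j

/-- Residual demands of `starPlan`. -/
noncomputable def starResidual (i : ℕ) (j : Fin m) : ℝ :=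
  residualDemand (allowed s k) (starSupply s b) b i j

variable {s b k}

lemma sum_starSupply (l : ℕ) : ∑ i ∈ range l, starSupply s b i = ∑ j ∈ servedBelow s l, b j := by
  unfold starSupply
  rw [← sum_fiberwise_of_maps_to (s := servedBelow s l) (t := range l) (g := s)
    (by simp [servedBelow])]
  refine sum_congr rfl fun i hi => sum_congr ?_ fun _ _ => rfl
  ext j
  simp only [servedBelow, mem_filter, mem_univ, true_and]
  have := mem_range.1 hi
  omega

lemma sum_card_star (l : ℕ) :
    ∑ i ∈ range l, #{j | s j = i} = #(servedBelow s l) := by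
  rw [card_eq_sum_card_fiberwise (f := s) (s := servedBelow s l) (t := range l)
    (by intro j; simp [servedBelow])]
  refine sum_congr rfl fun i hi => congrArg card ?_
  ext j
  simp only [servedBelow, mem_filter, mem_univ, true_and]
  have := mem_range.1 hi
  omega

lemma star_subset_servedBelow {i : ℕ} (hi : i < k) :
    ({j | s j = i} : Finset (Fin m)) ⊆ servedBelow s k := by
  intro j
  simp only [servedBelow, mem_filter, mem_univ, true_and]
  omega

lemma starSupply_nonneg (hb : ∀ j, 0 ≤ b j) (i : ℕ) : 0 ≤ starSupply s b i :=
  sum_nonneg fun j _ => hb j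

lemma mem_allowed_of_pos (hb : ∀ j, 0 ≤ b j) {i : ℕ} {j : Fin m} (h : 0 < starPlan s b k i j) :
    j ∈ allowed s k i :=
  mem_of_fill_pos (residualDemand_nonneg hb i) h

lemma allowed_disjoint {i i' : ℕ} (hi : i < k) (hi' : i' < k) (h : i ≠ i') {j : Fin m}
    (hj : j ∈ allowed s k i) : j ∉ allowed s k i' := by
  rw [allowed, if_pos hi] at hj
  rw [allowed, if_pos hi']
  intro hj'
  obtain ⟨x, hx, hxj⟩ := mem_image.1 hj
  obtain ⟨y, hy, hyj⟩ := mem_image.1 hj'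
  have := rankIn_injOn _ (star_subset_servedBelow hi hx) (star_subset_servedBelow hi' hy)
    (hxj.trans hyj.symm)
  subst this
  simp only [mem_filter, mem_univ, true_and] at hx hy
  omega

lemma lt_card_of_mem_allowed {i : ℕ} (hi : i < k) {j : Fin m} (hj : j ∈ allowed s k i) :
    (j : ℕ) < #(servedBelow s k) := by
  rw [allowed, if_pos hi] at hj
  obtain ⟨x, hx, rfl⟩ := mem_image.1 hj
  exact rankIn_lt_card _ (star_subset_servedBelow hi hx)

lemma sum_starPlan (hb : ∀ j, 0 ≤ b j) (hbm : Antitone b) (i : ℕ) :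
    ∑ j, starPlan s b k i j = starSupply s b i := by
  induction i using Nat.strong_induction_on with
  | _ i ih =>
  have hfill : ∑ j, starPlan s b k i j
      = min (starSupply s b i) (∑ j ∈ allowed s k i, starResidual s b k i j) :=
    sum_fill (starSupply_nonneg hb i)
  rw [hfill, min_eq_left]
  by_cases hi : i < k
  · have hres : ∀ j ∈ allowed s k i, starResidual s b k i j = b j := by
      intro j hj
      rw [starResidual, residualDemand_eq, sum_eq_zero, sub_zero]
      intro i' hi'
      have hlt := mem_range.1 hi'
      by_contra hne
      exact allowed_disjoint hi (hlt.trans hi) hlt.ne' hj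
        (mem_allowed_of_pos hb ((greedy_nonneg hb i' j).lt_of_ne' hne))
    rw [sum_congr rfl hres, allowed, if_pos hi]
    exact sum_le_sum_image_rankIn _ hbm (star_subset_servedBelow hi)
  · rw [allowed, if_neg hi]
    have h1 : ∑ j, starResidual s b k i j = ∑ j, b j - ∑ i' ∈ range i, starSupply s b i' := by
      simp only [starResidual, residualDemand_eq, sum_sub_distrib]
      rw [sum_comm]
      exact congrArg _ (sum_congr rfl fun i' hi' => ih i' (mem_range.1 hi'))
    have h2 : ∑ i' ∈ range (i + 1), starSupply s b i' ≤ ∑ j, b j := by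
      rw [sum_starSupply]
      exact sum_le_sum_of_subset_of_nonneg (subset_univ _) fun j _ _ => hb j
    rw [sum_range_succ] at h2
    linarith

lemma sum_starResidual (hb : ∀ j, 0 ≤ b j) (hbm : Antitone b) (l : ℕ) :
    ∑ j, starResidual s b k l j = ∑ j, b j - ∑ j ∈ servedBelow s l, b j := by
  simp only [starResidual, residualDemand_eq, sum_sub_distrib]
  rw [sum_comm, ← sum_starSupply]
  exact congrArg _ (sum_congr rfl fun i' _ => sum_starPlan hb hbm i')

lemma starResidual_eq_zero (hb : ∀ j, 0 ≤ b j) (hbm : Antitone b) {n : ℕ} (hs : ∀ j, s j < n)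
    (j : Fin m) : starResidual s b k n j = 0 := by
  have h := sum_starResidual (k := k) hb hbm (s := s) n
  have hu : servedBelow s n = univ := by
    ext j
    simp [servedBelow, hs]
  rw [hu, sub_self] at h
  exact (sum_eq_zero_iff_of_nonneg fun j _ => residualDemand_nonneg hb n j).1 h j (mem_univ j)

lemma sum_range_starPlan (hb : ∀ j, 0 ≤ b j) (hbm : Antitone b) {n : ℕ} (hs : ∀ j, s j < n)
    (j : Fin m) : ∑ i ∈ range n, starPlan s b k i j = b j := by
  have h := starResidual_eq_zero (k := k) hb hbm hs j
  rw [starResidual, residualDemand_eq] at h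
  exact (sub_eq_zero.1 h).symm

lemma starResidual_eq_zero_of_pos (hb : ∀ j, 0 ≤ b j) {i : ℕ} {j j' : Fin m}
    (hT : #(servedBelow s k) ≤ (j' : ℕ)) (h : 0 < starPlan s b k i j') (hj : j < j') :
    starResidual s b k (i + 1) j = 0 := by
  have hi : ¬ i < k := fun hi =>
    absurd (lt_card_of_mem_allowed hi (mem_allowed_of_pos hb h)) (by omega)
  exact residualDemand_eq_zero_of_lt hb hj (by simp [allowed, hi]) h

lemma card_starPlan_pos_le (hb : ∀ j, 0 ≤ b j) {i : ℕ} (hi : i < k) :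
    #{j | 0 < starPlan s b k i j} ≤ #{j | s j = i} := by
  refine (card_le_card (t := allowed s k i) fun j hj => ?_).trans ?_
  · exact mem_allowed_of_pos hb (mem_filter.1 hj).2
  · rw [allowed, if_pos hi]
    exact card_image_le

lemma card_starResidual_eq_zero_le (hb : ∀ j, 0 < b j) (hbm : Antitone b) {l : ℕ}
    (hT : #(servedBelow s k) ≤ #(servedBelow s l)) :
    #{j | starResidual s b k l j = 0} ≤ #(servedBelow s l) := by
  have hb0 : ∀ j, 0 ≤ b j := fun j => (hb j).le
  set F : Finset (Fin m) := {j | starResidual s b k l j = 0} with hF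
  set D := #(servedBelow s l) with hD
  by_contra! hlt
  obtain ⟨j, hjF, hjD⟩ : ∃ j ∈ F, D ≤ (j : ℕ) := by
    by_contra! hc
    have h1 : #(F.image Fin.val) ≤ #(range D) := card_le_card fun x hx => by
      obtain ⟨j, hj, rfl⟩ := mem_image.1 hx
      exact mem_range.2 (hc j hj)
    rw [card_image_of_injective _ Fin.val_injective, card_range] at h1
    omega
  have hsub : insert j ({j' | j'.val < D} : Finset (Fin m)) ⊆ F := by
    intro j' hj'
    rcases mem_insert.1 hj' with rfl | hj'
    · exact hjF
    obtain ⟨i, hil, hpos⟩ := exists_greedy_pos (hb j) (mem_filter.1 hjF).2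
    have hj'j : j' < j := Fin.lt_def.2 ((mem_filter.1 hj').2.trans_le hjD)
    have h0 := starResidual_eq_zero_of_pos hb0 (hT.trans hjD) hpos hj'j
    refine mem_filter.2 ⟨mem_univ _, le_antisymm ?_ (residualDemand_nonneg hb0 _ _)⟩
    exact h0 ▸ residualDemand_anti hb0 j' (Nat.succ_le_of_lt hil)
  have h1 : ∑ j ∈ F, b j ≤ ∑ j ∈ servedBelow s l, b j := by
    have hres : ∑ j, (b j - starResidual s b k l j) = ∑ j ∈ servedBelow s l, b j := by
      rw [sum_sub_distrib, sum_starResidual hb0 hbm]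
      ring
    rw [← hres]
    calc ∑ j ∈ F, b j = ∑ j ∈ F, (b j - starResidual s b k l j) :=
          sum_congr rfl fun j hj => by rw [(mem_filter.1 hj).2, sub_zero]
      _ ≤ _ := sum_le_sum_of_subset_of_nonneg (subset_univ _) fun j _ _ =>
          sub_nonneg.2 (residualDemand_anti hb0 j (Nat.zero_le l))
  have h2 := sum_le_sum_of_subset_of_nonneg hsub fun j _ _ => hb0 j
  rw [sum_insert (by simpa using hjD)] at h2
  have h3 := sum_le_sum_lt_card (servedBelow s l) hbm hb0
  have h4 := hb j
  linarith

lemma exists_cutoff {q n : ℕ} (hq : 0 < q) (hqm : q ≤ m) (hs : ∀ j, s j < n) :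
    ∃ k, #(servedBelow s k) < q ∧ ∀ l, k < l → q ≤ #(servedBelow s l) := by
  have hmono : ∀ l l', l ≤ l' → #(servedBelow s l) ≤ #(servedBelow s l') := by
    intro l l' h
    refine card_le_card fun j => ?_
    simp only [servedBelow, mem_filter, mem_univ, true_and]
    omega
  have hex : ∃ l, q ≤ #(servedBelow s (l + 1)) := by
    refine ⟨n, ?_⟩
    have hu : servedBelow s (n + 1) = univ := by
      ext j
      simp [servedBelow, (hs j).le]
    rwa [hu, card_univ, Fintype.card_fin]
  refine ⟨Nat.find hex, ?_, fun l hl => (Nat.find_spec hex).trans (hmono _ _ hl)⟩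
  rcases Nat.eq_zero_or_pos (Nat.find hex) with h0 | hpos
  · rw [h0]
    simpa [servedBelow] using hq
  · have := Nat.find_min hex (Nat.sub_one_lt hpos.ne')
    rw [Nat.sub_one_add_one hpos.ne'] at this
    omega

lemma sum_card_starPlan_pos_le (hb : ∀ j, 0 < b j) (hbm : Antitone b) {q n l : ℕ} {ε : ℝ}
    (hε : 0 < ε) (hn : (n : ℝ) ≤ ε * q) (hk : #(servedBelow s k) < q)
    (hkl : ∀ l, k < l → q ≤ #(servedBelow s l)) (hl : l ≤ n) :
    ((∑ i ∈ range l, #{j | 0 < starPlan s b k i j} : ℕ) : ℝ)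
      ≤ (1 + ε) * (∑ i ∈ range l, #{j | s j = i} : ℕ) := by
  have hb0 : ∀ j, 0 ≤ b j := fun j => (hb j).le
  rcases le_or_gt l k with hlk | hlk
  · have h : ∑ i ∈ range l, #{j | 0 < starPlan s b k i j} ≤ ∑ i ∈ range l, #{j | s j = i} :=
      sum_le_sum fun i hi => card_starPlan_pos_le hb0 ((mem_range.1 hi).trans_le hlk)
    have h' : ((∑ i ∈ range l, #{j | 0 < starPlan s b k i j} : ℕ) : ℝ)
      ≤ (∑ i ∈ range l, #{j | s j = i} : ℕ) := by exact_mod_cast h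
    have h0 : (0 : ℝ) ≤ (∑ i ∈ range l, #{j | s j = i} : ℕ) := Nat.cast_nonneg _
    nlinarith
  · have hq := hkl l hlk
    have h1 : ∑ i ∈ range l, #{j | 0 < starPlan s b k i j}
        ≤ #{j | starResidual s b k l j = 0} + l := sum_card_greedy_pos_le hb0 l
    have h2 := card_starResidual_eq_zero_le hb hbm (hk.le.trans hq)
    have h3 : ((∑ i ∈ range l, #{j | 0 < starPlan s b k i j} : ℕ) : ℝ)
        ≤ (#(servedBelow s l) : ℝ) + n := by exact_mod_cast (by omega)
    rw [sum_card_star]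
    have h4 : (q : ℝ) ≤ #(servedBelow s l) := by exact_mod_cast hq
    nlinarith

lemma le_card_starPlan_pos (hb : ∀ j, 0 < b j) {n q : ℕ} {f : Fin n → ℝ} (hf : Antitone f)
    (hk : #(servedBelow s k) ≤ q) {i : Fin n} {j : Fin m} (h : 0 < starPlan s b k i j)
    (hj : q ≤ (j : ℕ)) :
    q ≤ #{p : Fin n × Fin m | 0 < starPlan s b k p.1 p.2 ∧ (p.2 : ℕ) < q ∧ f i ≤ f p.1} := by
  have hex : ∀ t : Fin q, ∃ i' : Fin n, i' ≤ i ∧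
      0 < starPlan s b k i' ⟨t, t.2.trans_le (hj.trans j.2.le)⟩ := by
    intro t
    have h0 := starResidual_eq_zero_of_pos (fun j => (hb j).le) (hk.trans hj) h
      (j := ⟨t, t.2.trans_le (hj.trans j.2.le)⟩) (Fin.lt_def.2 (t.2.trans_le hj))
    obtain ⟨i', hi', hpos⟩ := exists_greedy_pos (hb _) h0
    exact ⟨⟨i', hi'.trans_le i.2⟩, Fin.le_def.2 (Nat.lt_succ_iff.1 hi'), hpos⟩
  choose g hg hpos using hex
  have hcard := card_le_card_of_injOn (s := (univ : Finset (Fin q)))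
    (t := {p : Fin n × Fin m | 0 < starPlan s b k p.1 p.2 ∧ (p.2 : ℕ) < q ∧ f i ≤ f p.1})
    (fun t => (g t, ⟨t, t.2.trans_le (hj.trans j.2.le)⟩))
    (fun t _ => by simpa using ⟨hpos t, hf (hg t)⟩)
    (fun t _ t' _ htt => by simpa [Fin.ext_iff] using (Prod.ext_iff.1 htt).2)
  simpa using hcard

end Stars

lemma costF_eq_sum_card {n m : ℕ} (f : Fin n → ℝ) (x : Fin n → Fin m → ℝ) :
    costF f x = ∑ i, f i * #{j | 0 < x i j} := by
  refine sum_congr rfl fun i _ => ?_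
  rw [← sum_filter, sum_const, nsmul_eq_mul, mul_comm]

lemma sum_mul_le_sum_mul_of_antitone {n : ℕ} {f : Fin n → ℝ} (hf : Antitone f)
    (hf0 : ∀ i, 0 ≤ f i) {u v : ℕ → ℝ}
    (h : ∀ l ≤ n, ∑ i ∈ range l, u i ≤ ∑ i ∈ range l, v i) :
    ∑ i, f i * u i ≤ ∑ i, f i * v i := by
  let g : ℕ → ℝ := fun i => if hi : i < n then f ⟨i, hi⟩ else 0
  let w : ℕ → ℝ := fun i => if i < n then v i - u i else 0
  have hg : Antitone g := by
    intro i i' hii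
    by_cases hi' : i' < n
    · simpa [g, hi', hii.trans_lt hi'] using hf (Fin.mk_le_mk.2 hii)
    · by_cases hi : i < n
      · simpa [g, hi, hi'] using hf0 _
      · simp [g, hi, hi']
  have hg0 : ∀ i, 0 ≤ g i := by
    intro i
    by_cases hi : i < n
    · simpa [g, hi] using hf0 _
    · simp [g, hi]
  have hw : ∀ l, 0 ≤ ∑ i ∈ range l, w i := by
    intro l
    have hr : (range l).filter (fun i => i < n) = range (min l n) := by
      ext i
      simp
    rw [← sum_filter, hr, sum_sub_distrib, sub_nonneg]
    exact h _ (min_le_right _ _)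
  have key := sum_mul_nonneg_of_antitone hg hg0 hw n
  rw [← Fin.sum_univ_eq_sum_range (fun i => g i * w i)] at key
  simp only [g, w, Fin.is_lt, dite_true, if_true, Fin.eta, mul_sub, sum_sub_distrib] at key
  linarith

/-- if the optimum solution `x*` of a PFCT-S instance (with sorted costs
and demands) is a disjoint union of stars centered at sources, then there is a
`(1 + ε)`-approximate solution `x` whose `q = n/ε` most expensive support edges are all
incident to the `q` sinks of largest demand: for every support edge `(i, j)` with
`j > q` (1-indexed) there are at least `q` support edges `(i', j')` with `j' ≤ q` and
`f_{i'} ≥ f_i`. -/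
theorem stmt_18
    (n m : ℕ) (hn : 0 < n) (hm : 0 < m)
    (a : Fin n → ℤ) (ha : ∀ i, 0 < a i)
    (b : Fin m → ℤ) (hb : ∀ j, 0 < b j)
    (hab : ∑ i, a i = ∑ j, b j)
    (f : Fin n → ℝ) (hf0 : ∀ i, 0 ≤ f i)
    (hfmono : ∀ i i' : Fin n, i ≤ i' → f i' ≤ f i)
    (hbmono : ∀ j j' : Fin m, j ≤ j' → b j' ≤ b j)
    (ε : ℝ) (hε : 0 < ε)
    (q : ℕ) (hq : 0 < q) (hqε : (q : ℝ) = (n : ℝ) / ε)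
    (xstar : Fin n → Fin m → ℝ)
    (hxs_nonneg : ∀ i j, 0 ≤ xstar i j)
    (hxs_row : ∀ i, ∑ j, xstar i j = (a i : ℝ))
    (hxs_col : ∀ j, ∑ i, xstar i j = (b j : ℝ))
    (hxs_opt : ∀ y : Fin n → Fin m → ℝ,
      (∀ i j, 0 ≤ y i j) → (∀ i, ∑ j, y i j = (a i : ℝ)) →
      (∀ j, ∑ i, y i j = (b j : ℝ)) → costF f xstar ≤ costF f y)
    (hxs_star : ∀ j : Fin m, ∃! i : Fin n, 0 < xstar i j) :
    ∃ x : Fin n → Fin m → ℝ,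
      (∀ i j, 0 ≤ x i j) ∧ (∀ i, ∑ j, x i j = (a i : ℝ)) ∧
      (∀ j, ∑ i, x i j = (b j : ℝ)) ∧
      costF f x ≤ (1 + ε) * costF f xstar ∧
      (∀ i : Fin n, ∀ j : Fin m, 0 < x i j → q ≤ (j : ℕ) →
        q ≤ ((Finset.univ : Finset (Fin n × Fin m)).filter
          (fun p => 0 < x p.1 p.2 ∧ (p.2 : ℕ) < q ∧ f i ≤ f p.1)).card) := by
  have hεn : (n : ℝ) ≤ ε * q := by
    rw [hqε, mul_div_cancel₀ _ hε.ne']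
  rcases lt_or_ge m q with hmq | hqm
  · refine ⟨xstar, hxs_nonneg, hxs_row, hxs_col, ?_, fun i j _ hj => ?_⟩
    · have h0 : 0 ≤ costF f xstar := sum_nonneg fun i _ => sum_nonneg fun j _ => by
        split_ifs
        exacts [hf0 i, le_rfl]
      nlinarith
    · exact absurd j.2 (by omega)
  choose σ hσ hσ' using hxs_star
  let s : Fin m → ℕ := fun j => σ j
  let β : Fin m → ℝ := fun j => b j
  have hs : ∀ j, s j < n := fun j => (σ j).2
  have hβ : ∀ j, 0 < β j := fun j => Int.cast_pos.2 (hb j)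
  have hβ0 : ∀ j, 0 ≤ β j := fun j => (hβ j).le
  have hβm : Antitone β := fun j j' h => Int.cast_le.2 (hbmono j j' h)
  have hpos : ∀ i j, 0 < xstar i j ↔ s j = i := fun i j =>
    ⟨fun h => (congrArg Fin.val (hσ' j i h)).symm, fun h => by
      rw [← Fin.ext h]
      exact hσ j⟩
  have hxs : ∀ i j, xstar i j = if s j = i then β j else 0 := by
    intro i j
    split_ifs with h
    · rw [← Fin.ext h, show β j = (b j : ℝ) from rfl, ← hxs_col j]
      symm
      refine sum_eq_single_of_mem _ (mem_univ _) fun i' _ hne => ?_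
      by_contra h0
      exact hne (hσ' j i' ((hxs_nonneg i' j).lt_of_ne' h0))
    · by_contra h0
      exact h ((hpos i j).1 ((hxs_nonneg i j).lt_of_ne' h0))
  have hsupply : ∀ i : Fin n, starSupply s β i = a i := by
    intro i
    rw [← hxs_row i, starSupply, sum_filter]
    exact sum_congr rfl fun j _ => (hxs i j).symm
  obtain ⟨k, hk, hkl⟩ := exists_cutoff hq hqm hs
  refine ⟨fun i j => starPlan s β k i j, fun i j => greedy_nonneg hβ0 _ _,
    fun i => (sum_starPlan hβ0 hβm i).trans (hsupply i), fun j => ?_, ?_, fun i j h hj => ?_⟩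
  · exact (Fin.sum_univ_eq_sum_range (fun i => starPlan s β k i j) n).trans
      (sum_range_starPlan hβ0 hβm hs j)
  · rw [costF_eq_sum_card, costF_eq_sum_card]
    simp only [hpos]
    refine (sum_mul_le_sum_mul_of_antitone (fun i i' h => hfmono i i' h) hf0
      (u := fun i => #{j | 0 < starPlan s β k i j}) (v := fun i => (1 + ε) * #{j | s j = i})
      fun l hl => ?_).trans_eq ?_
    · rw [← mul_sum]
      exact_mod_cast sum_card_starPlan_pos_le hβ hβm hε hεn hk hkl hl
    · rw [mul_sum]
      exact sum_congr rfl fun i _ => by ring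
  · exact le_card_starPlan_pos hβ (fun i i' h => hfmono i i' h) hk.le h hj
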